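/- Suppose m ≥ 2 and n_i ≥ 2 for every type i. Then the extreme equilibrium (0, …, 0) is stable if and only if the maximum at k = 1 over all 2m lines is attained by some defective line, and the extreme equilibrium (n_1, …, n_m) is stable if and only if the maximum at k = n−1 over all 2m lines is attained by some cooperative line. Moreover, if the maximum at k = 1 over all 2m lines is attained only by defective lines, then every state x with nC(x) = 1 has the all-defect state (0, …, 0) among its one-step successors, and every one-step successor y of such an x satisfies nC(y) ≤ 1. -/

import Mathlib

/-- A finite well-mixed population with `m ≥ 1` types: type `i` consists of
`nvec i ≥ 1` identical agents with real payoff entries `R i, S i, T i, P i`. -/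
structure Pop (m : ℕ) where
  hm : 0 < m
  nvec : Fin m → ℕ
  hnvec : ∀ i, 1 ≤ nvec i
  R : Fin m → ℝ
  S : Fin m → ℝ
  T : Fin m → ℝ
  P : Fin m → ℝ

variable {m : ℕ}

/-- The total number `n` of agents. -/
def nTot (pop : Pop m) : ℕ := ∑ i, pop.nvec i

/-- Cooperative line of type `i`:  `u_i^C(k) = (R_i - S_i)·k + S_i·n`. -/
noncomputable def uC (pop : Pop m) (i : Fin m) (k : ℝ) : ℝ :=
  (pop.R i - pop.S i) * k + pop.S i * (nTot pop : ℝ)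

/-- Defective line of type `i`:  `u_i^D(k) = (T_i - P_i)·k + P_i·n`. -/
noncomputable def uD (pop : Pop m) (i : Fin m) (k : ℝ) : ℝ :=
  (pop.T i - pop.P i) * k + pop.P i * (nTot pop : ℝ)

/-- A state: `x i` cooperators of type `i`, with `x i ≤ nvec i`. -/
def IsState (pop : Pop m) (x : Fin m → ℕ) : Prop := ∀ i, x i ≤ pop.nvec i

/-- The total number of cooperators at state `x`. -/
def nC (x : Fin m → ℕ) : ℕ := ∑ i, x i

/-- The cooperative line of type `i` is active at `x`. -/
def activeC (x : Fin m → ℕ) (i : Fin m) : Prop := 0 < x i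

/-- The defective line of type `i` is active at `x`. -/
def activeD (pop : Pop m) (x : Fin m → ℕ) (i : Fin m) : Prop := x i < pop.nvec i

/-- `v` bounds from above the values, at `k = nC x`, of all lines active at `x`;
the value of an active line satisfying this attains the maximum `M(x)`. -/
def ubActive (pop : Pop m) (x : Fin m → ℕ) (v : ℝ) : Prop :=
  (∀ i, activeC x i → uC pop i (nC x) ≤ v) ∧
  (∀ i, activeD pop x i → uD pop i (nC x) ≤ v)

/-- Some active cooperative line attains the maximum `M(x)` over active lines. -/
def coopMax (pop : Pop m) (x : Fin m → ℕ) : Prop :=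
  ∃ i, activeC x i ∧ ubActive pop x (uC pop i (nC x))

/-- Some active defective line attains the maximum `M(x)` over active lines. -/
def defMax (pop : Pop m) (x : Fin m → ℕ) : Prop :=
  ∃ i, activeD pop x i ∧ ubActive pop x (uD pop i (nC x))

/-- One-step successor relation of the asynchronous imitation dynamics: one agent
is activated; an activated cooperator of type `i` switches (to `x - e_i`) exactly
when no active cooperative line attains `M(x)`, an activated defector of type `i`
switches (to `x + e_i`) exactly when no active defective line attains `M(x)`;
otherwise the state is unchanged. -/
def Step (pop : Pop m) (x y : Fin m → ℕ) : Prop :=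
  (∃ i, activeC x i ∧
    ((coopMax pop x ∧ y = x) ∨
     (¬ coopMax pop x ∧ y = Function.update x i (x i - 1)))) ∨
  (∃ i, activeD pop x i ∧
    ((defMax pop x ∧ y = x) ∨
     (¬ defMax pop x ∧ y = Function.update x i (x i + 1))))

/-- A trajectory of the dynamics. -/
def Traj (pop : Pop m) (X : ℕ → Fin m → ℕ) : Prop :=
  IsState pop (X 0) ∧ ∀ t, Step pop (X t) (X (t + 1))

/-- An equilibrium state: its only one-step successor is itself. -/
def IsEquilibrium (pop : Pop m) (x : Fin m → ℕ) : Prop :=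
  IsState pop x ∧ ∀ y, Step pop x y → y = x

/-- A positively invariant set of states. -/
def PosInv (pop : Pop m) (Q : Set (Fin m → ℕ)) : Prop :=
  (∀ x ∈ Q, IsState pop x) ∧ ∀ x ∈ Q, ∀ y, Step pop x y → y ∈ Q

/-- A minimal positively invariant set: no nonempty proper subset is positively
invariant. -/
def MinPosInv (pop : Pop m) (Q : Set (Fin m → ℕ)) : Prop :=
  PosInv pop Q ∧ ∀ Q' : Set (Fin m → ℕ), Q' ⊂ Q → Q'.Nonempty → ¬ PosInv pop Q'

/-- A fluctuation set: a minimal positively invariant set with more than one state. -/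
def FluctSet (pop : Pop m) (O : Set (Fin m → ℕ)) : Prop :=
  MinPosInv pop O ∧ ∃ x ∈ O, ∃ y ∈ O, x ≠ y

/-- `[a, b]` is the fluctuation interval of the fluctuation set `O`:
`a = min {nC x : x ∈ O}` and `b = max {nC x : x ∈ O}`. -/
def FluctInterval (pop : Pop m) (O : Set (Fin m → ℕ)) (a b : ℕ) : Prop :=
  FluctSet pop O ∧
  (∃ x ∈ O, nC x = a) ∧ (∀ x ∈ O, a ≤ nC x) ∧
  (∃ x ∈ O, nC x = b) ∧ (∀ x ∈ O, nC x ≤ b)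

/-- An intersection point of `u_i^C` and `u_j^D`: a value `k ∈ [1, n-1]` with
`u_i^C(k) = u_j^D(k)`. -/
def IsInterPt (pop : Pop m) (i j : Fin m) (k : ℝ) : Prop :=
  1 ≤ k ∧ k ≤ (nTot pop : ℝ) - 1 ∧ uC pop i k = uD pop j k

/-- Potentially attracting: `u_i^C(k - 1) > u_j^D(k - 1)`. -/
def PotAttract (pop : Pop m) (i j : Fin m) (k : ℝ) : Prop :=
  uD pop j (k - 1) < uC pop i (k - 1)

/-- A fluctuation point: a non-integer potentially attracting intersection point
`p_ij` with value `k` such that there are a state `x` with `nC x = ⌊k⌋` at which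
`u_i^C` is active and attains the maximum among the lines active at `x`, and a
state obtained from `x` by increasing exactly one coordinate by `1` at which
`u_j^D` is active and attains the maximum among the active lines. -/
def IsFluctPt (pop : Pop m) (i j : Fin m) (k : ℝ) : Prop :=
  IsInterPt pop i j k ∧ PotAttract pop i j k ∧ (∀ z : ℤ, (z : ℝ) ≠ k) ∧
  ∃ x, IsState pop x ∧ ((nC x : ℤ) = ⌊k⌋) ∧
    activeC x i ∧ ubActive pop x (uC pop i (nC x)) ∧
    ∃ l, IsState pop (Function.update x l (x l + 1)) ∧
      activeD pop (Function.update x l (x l + 1)) j ∧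
      ubActive pop (Function.update x l (x l + 1))
        (uD pop j (nC (Function.update x l (x l + 1))))

/-- `[lo, hi]` contains the value of a fluctuation point. -/
def HasFluctPtIn (pop : Pop m) (lo hi : ℝ) : Prop :=
  ∃ i j : Fin m, ∃ k : ℝ, IsFluctPt pop i j k ∧ lo ≤ k ∧ k ≤ hi

/-- `[a, a+1]` is a left wall: every trajectory starting with at least `a + 1`
cooperators always has at least `a` cooperators. -/
def LeftWall (pop : Pop m) (a : ℕ) : Prop :=
  ∀ X : ℕ → Fin m → ℕ, Traj pop X → a + 1 ≤ nC (X 0) → ∀ t, a ≤ nC (X t)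

/-- `[b-1, b]` is a right wall: every trajectory starting with at most `b - 1`
cooperators always has at most `b` cooperators. -/
def RightWall (pop : Pop m) (b : ℕ) : Prop :=
  ∀ X : ℕ → Fin m → ℕ, Traj pop X → nC (X 0) ≤ b - 1 → ∀ t, nC (X t) ≤ b

/-- The 1-norm distance between two states. -/
def dist1 (x y : Fin m → ℕ) : ℕ := ∑ i, ((x i : ℤ) - (y i : ℤ)).natAbs

/-- Lyapunov stability of an equilibrium state `s`. -/
def Stable (pop : Pop m) (s : Fin m → ℕ) : Prop :=
  ∀ ε : ℕ, 2 ≤ ε → ∃ δ : ℕ, 2 ≤ δ ∧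
    ∀ X : ℕ → Fin m → ℕ, Traj pop X → dist1 (X 0) s < δ → ∀ t, dist1 (X t) s < ε

lemma nC_update (x : Fin m → ℕ) (i : Fin m) (v : ℕ) :
    nC (Function.update x i v) + x i = nC x + v := by
  unfold nC
  rw [Finset.sum_update_of_mem (Finset.mem_univ i), ← Finset.add_sum_erase _ x (Finset.mem_univ i),
    Finset.sdiff_singleton_eq_erase]
  omega

lemma le_nC (x : Fin m → ℕ) (i : Fin m) : x i ≤ nC x :=
  Finset.single_le_sum (f := x) (fun _ _ => Nat.zero_le _) (Finset.mem_univ i)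

lemma step_total (pop : Pop m) (x : Fin m → ℕ) : ∃ y, Step pop x y := by
  let i : Fin m := ⟨0, pop.hm⟩
  by_cases h : 0 < x i
  · by_cases hc : coopMax pop x
    · exact ⟨_, Or.inl ⟨i, h, Or.inl ⟨hc, rfl⟩⟩⟩
    · exact ⟨_, Or.inl ⟨i, h, Or.inr ⟨hc, rfl⟩⟩⟩
  · have h' : activeD pop x i := by
      have := pop.hnvec i
      unfold activeD
      omega
    by_cases hc : defMax pop x
    · exact ⟨_, Or.inr ⟨i, h', Or.inl ⟨hc, rfl⟩⟩⟩
    · exact ⟨_, Or.inr ⟨i, h', Or.inr ⟨hc, rfl⟩⟩⟩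

lemma traj_exists (pop : Pop m) (x y : Fin m → ℕ) (hx : IsState pop x) (h : Step pop x y) :
    ∃ X, Traj pop X ∧ X 0 = x ∧ X 1 = y := by
  choose f hf using step_total pop
  refine ⟨fun t => Nat.casesOn t x (fun s => f^[s] y), ⟨hx, ?_⟩, rfl, rfl⟩
  intro t
  cases t with
  | zero => exact h
  | succ s =>
    show Step pop (f^[s] y) (f^[s+1] y)
    rw [Function.iterate_succ_apply']
    exact hf _

lemma step_state (pop : Pop m) (x y : Fin m → ℕ) (hx : IsState pop x) (h : Step pop x y) :
    IsState pop y := by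
  rcases h with ⟨i, hi, ⟨-, rfl⟩ | ⟨-, rfl⟩⟩ | ⟨i, hi, ⟨-, rfl⟩ | ⟨-, rfl⟩⟩
  · exact hx
  · intro j
    have := hx j
    by_cases hj : j = i
    · subst hj; simp; omega
    · simpa [hj] using this
  · exact hx
  · intro j
    have := hx j
    by_cases hj : j = i
    · subst hj; simp; exact hi
    · simpa [hj] using this

lemma traj_state (pop : Pop m) (X : ℕ → Fin m → ℕ) (h : Traj pop X) (t : ℕ) :
    IsState pop (X t) := by
  induction t with
  | zero => exact h.1
  | succ t ih => exact step_state pop _ _ ih (h.2 t)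

lemma dist1_zero (x : Fin m → ℕ) : dist1 x (fun _ => 0) = nC x := by
  simp [dist1, nC]

lemma dist1_top (pop : Pop m) (x : Fin m → ℕ) (hx : IsState pop x) :
    dist1 x pop.nvec + nC x = nTot pop := by
  unfold dist1 nC nTot
  rw [← Finset.sum_add_distrib]
  refine Finset.sum_congr rfl fun i _ => ?_
  have := hx i
  omega

lemma argmax (pop : Pop m) (f : Fin m → ℝ) : ∃ i, ∀ j, f j ≤ f i := by
  haveI : Nonempty (Fin m) := ⟨⟨0, pop.hm⟩⟩
  exact Finite.exists_max f

/-- near the bottom -/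
lemma low_defMax (pop : Pop m) (h2 : ∀ i, 2 ≤ pop.nvec i) (i : Fin m)
    (hC : ∀ j, uC pop j 1 ≤ uD pop i 1) (hD : ∀ j, uD pop j 1 ≤ uD pop i 1)
    (x : Fin m → ℕ) (hx : nC x ≤ 1) : defMax pop x := by
  have hact : ∀ j, activeD pop x j := fun j =>
    lt_of_lt_of_le (Nat.lt_succ_of_le ((le_nC x j).trans hx)) (h2 j)
  rcases Nat.le_one_iff_eq_zero_or_eq_one.1 hx with h0 | h1
  · obtain ⟨k, hk⟩ := argmax pop (fun j => uD pop j (nC x))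
    refine ⟨k, hact k, fun j hj => ?_, fun j _ => hk j⟩
    have := le_nC x j
    unfold activeC at hj
    omega
  · refine ⟨i, hact i, ?_, ?_⟩ <;> rw [h1] <;> intro j _
    · simpa using hC j
    · simpa using hD j

lemma low_step (pop : Pop m) (h2 : ∀ i, 2 ≤ pop.nvec i) (i : Fin m)
    (hC : ∀ j, uC pop j 1 ≤ uD pop i 1) (hD : ∀ j, uD pop j 1 ≤ uD pop i 1)
    (x y : Fin m → ℕ) (hx : nC x ≤ 1) (h : Step pop x y) : nC y ≤ 1 := by
  have hd := low_defMax pop h2 i hC hD x hx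
  rcases h with ⟨j, hj, ⟨-, rfl⟩ | ⟨-, rfl⟩⟩ | ⟨j, hj, ⟨-, rfl⟩ | ⟨hn, -⟩⟩
  · exact hx
  · have := nC_update x j (x j - 1)
    omega
  · exact hx
  · exact absurd hd hn

lemma high_coopMax (pop : Pop m) (h2 : ∀ i, 2 ≤ pop.nvec i) (i : Fin m)
    (hC : ∀ j, uC pop j ((nTot pop : ℝ) - 1) ≤ uC pop i ((nTot pop : ℝ) - 1))
    (hD : ∀ j, uD pop j ((nTot pop : ℝ) - 1) ≤ uC pop i ((nTot pop : ℝ) - 1))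
    (x : Fin m → ℕ) (hs : IsState pop x) (hx : dist1 x pop.nvec ≤ 1) : coopMax pop x := by
  have hle : ∀ j, ((x j : ℤ) - (pop.nvec j : ℤ)).natAbs ≤ dist1 x pop.nvec := fun j =>
    Finset.single_le_sum (f := fun j => ((x j : ℤ) - (pop.nvec j : ℤ)).natAbs)
      (fun _ _ => Nat.zero_le _) (Finset.mem_univ j)
  have hact : ∀ j, activeC x j := fun j => by
    have := hle j
    have := h2 j
    unfold activeC
    omega
  have hd := dist1_top pop x hs
  rcases Nat.le_one_iff_eq_zero_or_eq_one.1 hx with h0 | h1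
  · obtain ⟨k, hk⟩ := argmax pop (fun j => uC pop j (nC x))
    refine ⟨k, hact k, fun j _ => hk j, fun j hj => ?_⟩
    have := hle j
    unfold activeD at hj
    omega
  · have hk : (nC x : ℝ) = (nTot pop : ℝ) - 1 := by
      rw [← hd, h1]; push_cast; ring
    refine ⟨i, hact i, ?_, ?_⟩ <;> rw [hk] <;> intro j _
    · exact hC j
    · exact hD j

lemma high_step (pop : Pop m) (h2 : ∀ i, 2 ≤ pop.nvec i) (i : Fin m)
    (hC : ∀ j, uC pop j ((nTot pop : ℝ) - 1) ≤ uC pop i ((nTot pop : ℝ) - 1))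
    (hD : ∀ j, uD pop j ((nTot pop : ℝ) - 1) ≤ uC pop i ((nTot pop : ℝ) - 1))
    (x y : Fin m → ℕ) (hs : IsState pop x) (hx : dist1 x pop.nvec ≤ 1) (h : Step pop x y) :
    dist1 y pop.nvec ≤ 1 := by
  have hd := high_coopMax pop h2 i hC hD x hs hx
  have e1 := dist1_top pop x hs
  have e2 := dist1_top pop y (step_state pop x y hs h)
  rcases h with ⟨j, hj, ⟨-, rfl⟩ | ⟨hn, -⟩⟩ | ⟨j, hj, ⟨-, rfl⟩ | ⟨-, rfl⟩⟩
  · exact hx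
  · exact absurd hd hn
  · exact hx
  · have := nC_update x j (x j + 1)
    omega

/-- stability of the two extreme equilibria when every type has at
least two agents, together with the behavior at states with one cooperator when
the maximum at `k = 1` is attained only by defective lines. -/
theorem stmt13 (pop : Pop m) (hm : 2 ≤ m) (h2 : ∀ i, 2 ≤ pop.nvec i) :
    (Stable pop (fun _ => 0) ↔
      ∃ i, (∀ j, uC pop j 1 ≤ uD pop i 1) ∧ (∀ j, uD pop j 1 ≤ uD pop i 1)) ∧
    (Stable pop pop.nvec ↔
      ∃ i, (∀ j, uC pop j ((nTot pop : ℝ) - 1) ≤ uC pop i ((nTot pop : ℝ) - 1)) ∧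
           (∀ j, uD pop j ((nTot pop : ℝ) - 1) ≤ uC pop i ((nTot pop : ℝ) - 1))) ∧
    ((∀ i, ∃ j, uC pop i 1 < uD pop j 1) →
      ∀ x : Fin m → ℕ, IsState pop x → nC x = 1 →
        Step pop x (fun _ => 0) ∧ ∀ y, Step pop x y → nC y ≤ 1) := by
  refine ⟨⟨fun hst => ?_, ?_⟩, ⟨fun hst => ?_, ?_⟩, ?_⟩
  · by_contra hno
    obtain ⟨i, hi⟩ := argmax pop (fun j => uC pop j 1)
    have hlt : ∀ k, uD pop k 1 < uC pop i 1 := by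
      intro k
      by_contra hk
      obtain ⟨l, hl⟩ := argmax pop (fun j => uD pop j 1)
      exact hno ⟨l, fun j => (hi j).trans ((not_lt.1 hk).trans (hl k)), hl⟩
    let x : Fin m → ℕ := Function.update (fun _ => 0) i 1
    have hxi : x i = 1 := by simp [x]
    have hnx : nC x = 1 := by
      have := nC_update (fun _ => 0) i 1
      simpa [nC] using this
    have hs : IsState pop x := fun j => by
      have := le_nC x j
      have := h2 j
      omega
    have hnd : ¬ defMax pop x := by
      rintro ⟨k, -, hk, -⟩
      have := hk i (by unfold activeC; omega)
      rw [hnx] at this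
      have h3 := hlt k
      simp only [Nat.cast_one] at this
      linarith
    have hstep : Step pop x (Function.update x i (x i + 1)) :=
      Or.inr ⟨i, by unfold activeD; have := h2 i; omega, Or.inr ⟨hnd, rfl⟩⟩
    obtain ⟨X, hX, h0, h1⟩ := traj_exists pop _ _ hs hstep
    obtain ⟨δ, hδ, H⟩ := hst 2 le_rfl
    have := H X hX (by rw [h0, dist1_zero]; omega) 1
    rw [h1, dist1_zero] at this
    have := nC_update x i (x i + 1)
    omega
  · rintro ⟨i, hC, hD⟩ ε hε
    refine ⟨2, le_rfl, fun X hX h0 t => ?_⟩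
    rw [dist1_zero] at h0 ⊢
    have : nC (X t) ≤ 1 := by
      induction t with
      | zero => omega
      | succ t ih => exact low_step pop h2 i hC hD _ _ ih (hX.2 t)
    omega
  · by_contra hno
    obtain ⟨i, hi⟩ := argmax pop (fun j => uD pop j ((nTot pop : ℝ) - 1))
    have hlt : ∀ k, uC pop k ((nTot pop : ℝ) - 1) < uD pop i ((nTot pop : ℝ) - 1) := by
      intro k
      by_contra hk
      obtain ⟨l, hl⟩ := argmax pop (fun j => uC pop j ((nTot pop : ℝ) - 1))
      exact hno ⟨l, hl, fun j => (hi j).trans ((not_lt.1 hk).trans (hl k))⟩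
    let x : Fin m → ℕ := Function.update pop.nvec i (pop.nvec i - 1)
    have hxi : x i = pop.nvec i - 1 := by simp [x]
    have h2i := h2 i
    have hnx : nC x + 1 = nTot pop := by
      have h := nC_update pop.nvec i (pop.nvec i - 1)
      have h' : nC pop.nvec = nTot pop := rfl
      change nC x + _ = _ at h
      omega
    have hs : IsState pop x := fun j => by
      by_cases hj : j = i
      · subst hj; omega
      · simp [x, hj]
    have hk : (nC x : ℝ) = (nTot pop : ℝ) - 1 := by
      rw [← hnx]; push_cast; ring
    have hnd : ¬ coopMax pop x := by
      rintro ⟨k, -, -, hkk⟩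
      have := hkk i (by unfold activeD; omega)
      rw [hk] at this
      have h3 := hlt k
      linarith
    have hstep : Step pop x (Function.update x i (x i - 1)) :=
      Or.inl ⟨i, by unfold activeC; omega, Or.inr ⟨hnd, rfl⟩⟩
    obtain ⟨X, hX, h0, h1⟩ := traj_exists pop _ _ hs hstep
    obtain ⟨δ, hδ, H⟩ := hst 2 le_rfl
    have e1 := dist1_top pop x hs
    have e2 := dist1_top pop _ (step_state pop _ _ hs hstep)
    have := H X hX (by rw [h0]; omega) 1
    rw [h1] at this
    have := nC_update x i (x i - 1)
    omega
  · rintro ⟨i, hC, hD⟩ ε hε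
    refine ⟨2, le_rfl, fun X hX h0 t => ?_⟩
    have : dist1 (X t) pop.nvec ≤ 1 := by
      induction t with
      | zero => omega
      | succ t ih => exact high_step pop h2 i hC hD _ _ (traj_state pop X hX t) ih (hX.2 t)
    omega
  · intro hall x hs hx
    obtain ⟨l, hl⟩ := argmax pop (fun j => uD pop j 1)
    have hC : ∀ j, uC pop j 1 < uD pop l 1 := fun j => by
      obtain ⟨k, hk⟩ := hall j
      exact hk.trans_le (hl k)
    refine ⟨?_, fun y hy => low_step pop h2 l (fun j => (hC j).le) hl x y hx.le hy⟩
    have hnc : ¬ coopMax pop x := by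
      rintro ⟨k, -, -, hk⟩
      have := hk l (by unfold activeD; have := le_nC x l; have := h2 l; omega)
      rw [hx] at this
      have h3 := hC k
      simp only [Nat.cast_one] at this
      linarith
    obtain ⟨i, hi⟩ : ∃ i, 0 < x i := by
      by_contra hne
      push Not at hne
      have : nC x = 0 := Finset.sum_eq_zero fun i _ => Nat.le_zero.1 (hne i)
      omega
    refine Or.inl ⟨i, hi, Or.inr ⟨hnc, ?_⟩⟩
    funext j
    have h3 := nC_update x i (x i - 1)
    have := le_nC (Function.update x i (x i - 1)) j
    have := le_nC x i
    omega
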